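/- The chain with transition density p is uniformly ergodic with stationary density φ in the following sense: sup over k ∈ 𝕋∖{0} and k' ∈ 𝕋∖{0} of φ(k')^{−1}·|p^m(k,k') − φ(k')| tends to 0 as m → ∞; in particular, for every m ≥ 1 the function (k,k') ↦ p^m(k,k')φ(k')^{−1} extends to a bounded function on 𝕋 × 𝕋. -/

import Mathlib

noncomputable section

open MeasureTheory ProbabilityTheory Real Filter Set Topology

/-- The one-dimensional torus `𝕋 = ℝ/ℤ`, identified with `[-1/2, 1/2)`. -/
def Tor : Set ℝ := Set.Ico (-(1/2) : ℝ) (1/2)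

/-- The velocity `v(k) = sin(2πk)/|sin(πk)|` (equal to `0` at `k = 0`). -/
def vv (k : ℝ) : ℝ := Real.sin (2 * π * k) / |Real.sin (π * k)|

/-- The scattering kernel `R(k,k')`. -/
def RR (k k' : ℝ) : ℝ :=
  (4 / 3) * (2 * Real.sin (2 * π * k) ^ 2 * Real.sin (π * k') ^ 2
    + 2 * Real.sin (2 * π * k') ^ 2 * Real.sin (π * k) ^ 2
    - Real.sin (2 * π * k) ^ 2 * Real.sin (2 * π * k') ^ 2)

/-- `φ(k) = ∫_𝕋 R(k,k') dk' = (4/3) sin²(πk)(1+2cos²(πk))`. -/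
def phi (k : ℝ) : ℝ := (4 / 3) * Real.sin (π * k) ^ 2 * (1 + 2 * Real.cos (π * k) ^ 2)

/-- The transition probability density `p(k,k') = R(k,k')/φ(k)` (for `k ≠ 0`). -/
def pp (k k' : ℝ) : ℝ := RR k k' / phi k

/-- `ψ(k) = v(k)/φ(k)` (equal to `0` at `k = 0`). -/
def psi (k : ℝ) : ℝ := vv k / phi k

/-- The `m`-step transition densities: `p¹ = p`,
`p^{m+1}(k,k') = ∫_𝕋 p^m(k,k₁) p(k₁,k') dk₁` (`p⁰` is set to `0`; it is never used). -/
def pm : ℕ → ℝ → ℝ → ℝ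
  | 0, _, _ => 0
  | 1, k, k' => pp k k'
  | (m + 2), k, k' => ∫ k₁ in Tor, pm (m + 1) k k₁ * pp k₁ k'

/-- The probability density `(8/3) sin⁴(πk)` on the torus. -/
def sinFourDensity (k : ℝ) : ℝ := 8 / 3 * Real.sin (π * k) ^ 4

/-- The probability density `8 sin²(πk) cos²(πk)` on the torus. -/
def sinCosDensity (k : ℝ) : ℝ := 8 * Real.sin (π * k) ^ 2 * Real.cos (π * k) ^ 2

/-- The weight of `sinFourDensity` in the mixture `pp k`. -/
def mixWeight (k : ℝ) : ℝ := 3 * Real.cos (π * k) ^ 2 / (1 + 2 * Real.cos (π * k) ^ 2)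

/-- The probability that the chain, started from `sinFourDensity`, selects it again. -/
def stayProb : ℝ := ∫ x in Tor, sinFourDensity x * mixWeight x

lemma one_add_two_mul_cos_sq_pos (k : ℝ) : 0 < 1 + 2 * Real.cos (π * k) ^ 2 := by positivity

lemma sinFourDensity_nonneg (k : ℝ) : 0 ≤ sinFourDensity k := by
  unfold sinFourDensity; positivity

lemma sinCosDensity_nonneg (k : ℝ) : 0 ≤ sinCosDensity k := by
  unfold sinCosDensity; positivity

lemma continuous_sinFourDensity : Continuous sinFourDensity := by
  unfold sinFourDensity; fun_prop

lemma continuous_sinCosDensity : Continuous sinCosDensity := by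
  unfold sinCosDensity; fun_prop

lemma continuous_mixWeight : Continuous mixWeight := by
  unfold mixWeight
  exact Continuous.div (by fun_prop) (by fun_prop) fun k => (one_add_two_mul_cos_sq_pos k).ne'

lemma mixWeight_nonneg (k : ℝ) : 0 ≤ mixWeight k := by
  unfold mixWeight; positivity

lemma mixWeight_le_one (k : ℝ) : mixWeight k ≤ 1 := by
  unfold mixWeight
  rw [div_le_one (one_add_two_mul_cos_sq_pos k)]
  linarith [Real.cos_sq_le_one (π * k)]

lemma phi_eq_average (k : ℝ) : phi k = (sinFourDensity k + sinCosDensity k) / 2 := by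
  unfold phi sinFourDensity sinCosDensity
  rw [Real.cos_sq']
  ring

lemma pp_eq_mixture {k : ℝ} (hk : Real.sin (π * k) ≠ 0) (k' : ℝ) :
    pp k k' = mixWeight k * sinFourDensity k' + (1 - mixWeight k) * sinCosDensity k' := by
  have h := (one_add_two_mul_cos_sq_pos k).ne'
  unfold pp RR phi mixWeight sinFourDensity sinCosDensity
  rw [show 2 * π * k = 2 * (π * k) by ring, show 2 * π * k' = 2 * (π * k') by ring,
    Real.sin_two_mul, Real.sin_two_mul]
  field_simp
  have h1 := Real.cos_sq' (π * k)
  have h2 := Real.cos_sq' (π * k')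
  simp only [h1, h2]
  ring

lemma sinCosDensity_mul_one_sub_mixWeight (k : ℝ) :
    sinCosDensity k * (1 - mixWeight k) = sinFourDensity k * mixWeight k := by
  have h := (one_add_two_mul_cos_sq_pos k).ne'
  unfold mixWeight sinFourDensity sinCosDensity
  field_simp
  have h1 := Real.cos_sq' (π * k)
  simp only [h1]
  ring

lemma integrableOn_Tor {f : ℝ → ℝ} (hf : Continuous f) : IntegrableOn f Tor :=
  (hf.integrableOn_Icc (a := -(1 / 2)) (b := 1 / 2)).mono_set Ico_subset_Icc_self

lemma setIntegral_Tor_eq (f : ℝ → ℝ) : ∫ x in Tor, f x = ∫ x in (-(1 / 2) : ℝ)..(1 / 2), f x := by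
  rw [Tor, integral_Ico_eq_integral_Ioc, intervalIntegral.integral_of_le (by norm_num)]

lemma integral_Tor_sin_pow (n : ℕ) : ∫ x in Tor, Real.sin (π * x) ^ (n + 2) =
    (n + 1) / (n + 2) * ∫ x in Tor, Real.sin (π * x) ^ n := by
  rw [setIntegral_Tor_eq, setIntegral_Tor_eq,
    intervalIntegral.integral_comp_mul_left (fun x => Real.sin x ^ (n + 2)) pi_ne_zero,
    intervalIntegral.integral_comp_mul_left (fun x => Real.sin x ^ n) pi_ne_zero,
    integral_sin_pow]
  have h : π * (1 / 2) = π / 2 := by ring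
  simp only [mul_neg, h, Real.cos_neg, Real.cos_pi_div_two, smul_eq_mul]
  ring

lemma integral_Tor_sin_sq : ∫ x in Tor, Real.sin (π * x) ^ 2 = 1 / 2 := by
  rw [integral_Tor_sin_pow 0, setIntegral_Tor_eq]
  norm_num

lemma integral_Tor_sin_four : ∫ x in Tor, Real.sin (π * x) ^ 4 = 3 / 8 := by
  rw [integral_Tor_sin_pow 2, integral_Tor_sin_sq]
  norm_num

lemma integral_Tor_sin_six : ∫ x in Tor, Real.sin (π * x) ^ 6 = 5 / 16 := by
  rw [integral_Tor_sin_pow 4, integral_Tor_sin_four]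
  norm_num

lemma integral_sinFourDensity : ∫ x in Tor, sinFourDensity x = 1 := by
  simp only [sinFourDensity]
  rw [integral_const_mul, integral_Tor_sin_four]
  norm_num

lemma integral_sinCosDensity : ∫ x in Tor, sinCosDensity x = 1 := by
  have h (x : ℝ) : sinCosDensity x = 8 * Real.sin (π * x) ^ 2 - 8 * Real.sin (π * x) ^ 4 := by
    rw [sinCosDensity, Real.cos_sq']
    ring
  simp only [h]
  rw [integral_sub (integrableOn_Tor (by fun_prop)) (integrableOn_Tor (by fun_prop)),
    integral_const_mul, integral_const_mul, integral_Tor_sin_sq, integral_Tor_sin_four]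
  norm_num

lemma integrableOn_sinFourDensity_mul_mixWeight :
    IntegrableOn (fun x => sinFourDensity x * mixWeight x) Tor :=
  integrableOn_Tor (continuous_sinFourDensity.mul continuous_mixWeight)

lemma one_div_six_le_stayProb : 1 / 6 ≤ stayProb := by
  have h : ∫ x in Tor, (8 / 3 * Real.sin (π * x) ^ 4 - 8 / 3 * Real.sin (π * x) ^ 6) = 1 / 6 := by
    rw [integral_sub (integrableOn_Tor (by fun_prop)) (integrableOn_Tor (by fun_prop)),
      integral_const_mul, integral_const_mul, integral_Tor_sin_six, integral_Tor_sin_four]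
    norm_num
  rw [← h]
  refine integral_mono (integrableOn_Tor (by fun_prop))
    integrableOn_sinFourDensity_mul_mixWeight fun x => ?_
  have hw : Real.cos (π * x) ^ 2 ≤ mixWeight x := by
    rw [mixWeight, le_div_iff₀ (one_add_two_mul_cos_sq_pos x)]
    nlinarith [Real.cos_sq_le_one (π * x), sq_nonneg (Real.cos (π * x))]
  calc _ = sinFourDensity x * Real.cos (π * x) ^ 2 := by
        rw [sinFourDensity, Real.cos_sq']; ring
    _ ≤ _ := mul_le_mul_of_nonneg_left hw (sinFourDensity_nonneg x)

lemma stayProb_le_half : stayProb ≤ 1 / 2 := by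
  have h : ∫ x in Tor, (3 * Real.sin (π * x) ^ 4 - 2 * Real.sin (π * x) ^ 6) = 1 / 2 := by
    rw [integral_sub (integrableOn_Tor (by fun_prop)) (integrableOn_Tor (by fun_prop)),
      integral_const_mul, integral_const_mul, integral_Tor_sin_six, integral_Tor_sin_four]
    norm_num
  rw [← h]
  refine integral_mono integrableOn_sinFourDensity_mul_mixWeight
    (integrableOn_Tor (by fun_prop)) fun x => ?_
  have hw : mixWeight x ≤ 3 / 8 + 3 / 4 * Real.cos (π * x) ^ 2 := by
    rw [mixWeight, div_le_iff₀ (one_add_two_mul_cos_sq_pos x)]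
    nlinarith [sq_nonneg (2 * Real.cos (π * x) ^ 2 - 1)]
  calc _ ≤ sinFourDensity x * (3 / 8 + 3 / 4 * Real.cos (π * x) ^ 2) :=
        mul_le_mul_of_nonneg_left hw (sinFourDensity_nonneg x)
    _ = _ := by rw [sinFourDensity, Real.cos_sq']; ring

lemma mixture_mul_pp (a x k' : ℝ) :
    (a * sinFourDensity x + (1 - a) * sinCosDensity x) * pp x k' =
      sinFourDensity x * mixWeight x * ((2 * a - 1) * (sinFourDensity k' - sinCosDensity k'))
        + sinFourDensity x * (a * sinCosDensity k')
        + sinCosDensity x * ((1 - a) * sinFourDensity k') := by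
  by_cases hx : Real.sin (π * x) = 0
  · simp [sinFourDensity, sinCosDensity, hx]
  · rw [pp_eq_mixture hx]
    linear_combination (1 - a) * (sinCosDensity k' - sinFourDensity k') *
      sinCosDensity_mul_one_sub_mixWeight x

/-- One step of the chain maps mixtures of the two densities to mixtures. -/
lemma integral_mixture_mul_pp (a k' : ℝ) :
    ∫ x in Tor, (a * sinFourDensity x + (1 - a) * sinCosDensity x) * pp x k' =
      (1 / 2 + (2 * stayProb - 1) * (a - 1 / 2)) * sinFourDensity k'
        + (1 - (1 / 2 + (2 * stayProb - 1) * (a - 1 / 2))) * sinCosDensity k' := by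
  have h1 := integrableOn_sinFourDensity_mul_mixWeight
  have h2 := integrableOn_Tor continuous_sinFourDensity
  have h3 := integrableOn_Tor continuous_sinCosDensity
  simp only [mixture_mul_pp]
  rw [integral_add ?_ (h3.mul_const _),
    integral_add (h1.mul_const _) (h2.mul_const _), integral_mul_const, integral_mul_const,
    integral_mul_const, integral_sinFourDensity, integral_sinCosDensity, ← stayProb]
  · ring
  · exact (h1.mul_const _).add (h2.mul_const _)

lemma pm_succ_eq_mixture {k : ℝ} (hk : Real.sin (π * k) ≠ 0) (m : ℕ) (k' : ℝ) :
    pm (m + 1) k k' =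
      (1 / 2 + (2 * stayProb - 1) ^ m * (mixWeight k - 1 / 2)) * sinFourDensity k'
        + (1 - (1 / 2 + (2 * stayProb - 1) ^ m * (mixWeight k - 1 / 2))) * sinCosDensity k' := by
  induction m generalizing k' with
  | zero =>
    rw [pm, pp_eq_mixture hk]
    ring
  | succ m ih =>
    rw [pm]
    simp only [ih]
    rw [integral_mixture_mul_pp]
    ring

lemma pm_zero_left (m : ℕ) (k' : ℝ) : pm m 0 k' = 0 := by
  induction m generalizing k' with
  | zero => rw [pm]
  | succ m ih =>
    cases m with
    | zero => simp [pm, pp, phi]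
    | succ m => simp [pm, ih]

lemma sin_pi_mul_ne_zero_of_mem_Tor {k : ℝ} (hk : k ∈ Tor) (hk0 : k ≠ 0) : Real.sin (π * k) ≠ 0 := by
  obtain ⟨h1, h2⟩ := hk
  have hp := pi_pos
  rw [Ne, Real.sin_eq_zero_iff_of_lt_of_lt (by nlinarith) (by nlinarith)]
  exact mul_ne_zero pi_ne_zero hk0

lemma phi_pos {k : ℝ} (hk : k ∈ Tor) (hk0 : k ≠ 0) : 0 < phi k := by
  have := sin_pi_mul_ne_zero_of_mem_Tor hk hk0
  unfold phi
  positivity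

lemma abs_pm_succ_sub_phi_le {k : ℝ} (hk : Real.sin (π * k) ≠ 0) (m : ℕ) (k' : ℝ) :
    |pm (m + 1) k k' - phi k'| ≤ (2 / 3) ^ m * phi k' := by
  have e : pm (m + 1) k k' - phi k' = (2 * stayProb - 1) ^ m * (mixWeight k - 1 / 2) *
      (sinFourDensity k' - sinCosDensity k') := by
    rw [pm_succ_eq_mixture hk, phi_eq_average]
    ring
  have hr : |2 * stayProb - 1| ≤ 2 / 3 :=
    abs_le.2 ⟨by linarith [one_div_six_le_stayProb], by linarith [stayProb_le_half]⟩
  have hw : |mixWeight k - 1 / 2| ≤ 1 / 2 :=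
    abs_le.2 ⟨by linarith [mixWeight_nonneg k], by linarith [mixWeight_le_one k]⟩
  have hd : |sinFourDensity k' - sinCosDensity k'| ≤ 2 * phi k' := by
    rw [phi_eq_average]
    exact abs_le.2 ⟨by linarith [sinFourDensity_nonneg k'], by linarith [sinCosDensity_nonneg k']⟩
  rw [e, abs_mul, abs_mul, abs_pow]
  calc _ ≤ (2 / 3) ^ m * (1 / 2) * (2 * phi k') := by gcongr
    _ = _ := by ring

/-- Uniform ergodicity: `sup_{k,k' ≠ 0} φ(k')⁻¹ |p^m(k,k') − φ(k')| → 0` as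
`m → ∞`, and for every `m ≥ 1` the function `(k,k') ↦ p^m(k,k')φ(k')⁻¹` is bounded. -/
theorem uniform_ergodicity :
    (∀ ε : ℝ, 0 < ε → ∃ M : ℕ, ∀ m : ℕ, M ≤ m →
      ∀ k ∈ Tor, k ≠ 0 → ∀ k' ∈ Tor, k' ≠ 0 →
        (phi k')⁻¹ * |pm m k k' - phi k'| < ε) ∧
    (∀ m : ℕ, 1 ≤ m → ∃ C : ℝ, ∀ k ∈ Tor, ∀ k' ∈ Tor, k' ≠ 0 →
        |pm m k k' * (phi k')⁻¹| ≤ C) := by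
  refine ⟨fun ε hε => ?_, fun m hm => ⟨2, fun k hk k' hk' hk0' => ?_⟩⟩
  · obtain ⟨N, hN⟩ := exists_pow_lt_of_lt_one hε (show (2 / 3 : ℝ) < 1 by norm_num)
    refine ⟨N + 1, fun m hm k hk hk0 k' hk' hk0' => ?_⟩
    obtain ⟨n, rfl⟩ : ∃ n, m = n + 1 := ⟨m - 1, by omega⟩
    rw [inv_mul_lt_iff₀ (phi_pos hk' hk0'), mul_comm]
    refine (abs_pm_succ_sub_phi_le (sin_pi_mul_ne_zero_of_mem_Tor hk hk0) n k').trans_lt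
      (mul_lt_mul_of_pos_right (lt_of_le_of_lt ?_ hN) (phi_pos hk' hk0'))
    exact pow_le_pow_of_le_one (by norm_num) (by norm_num) (by omega)
  · obtain ⟨n, rfl⟩ : ∃ n, m = n + 1 := ⟨m - 1, by omega⟩
    rcases eq_or_ne k 0 with rfl | hk0
    · simp [pm_zero_left]
    have hp := phi_pos hk' hk0'
    have h := abs_le.1 (abs_pm_succ_sub_phi_le (sin_pi_mul_ne_zero_of_mem_Tor hk hk0) n k')
    have hle : (2 / 3 : ℝ) ^ n * phi k' ≤ 1 * phi k' :=
      mul_le_mul_of_nonneg_right (pow_le_one₀ (by norm_num) (by norm_num)) hp.le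
    rw [abs_mul, abs_inv, abs_of_pos hp, ← div_eq_mul_inv, div_le_iff₀ hp]
    exact abs_le.2 ⟨by linarith, by linarith⟩
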